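/- Let n ≥ 1 and let A be an invertible 2×2 complex matrix. Then A is diagonalizable (there exists an invertible 2×2 matrix P with P^{−1}·A·P diagonal) if and only if ϱₙ(A) is diagonalizable (there exists an invertible (n+1)×(n+1) matrix Q with Q^{−1}·ϱₙ(A)·Q diagonal). In particular, ϱₙ sends parabolic elements of SL(2,ℂ) (non-diagonalizable elements) to non-diagonalizable elements of SL(n+1,ℂ), and elliptic and loxodromic elements to diagonalizable elements. -/

import Mathlib

open Matrix Filter Topology

/-- The Veronese lift `Ψₙ : ℂ² → ℂ^{n+1}`, whose `k`-th coordinate at `(x, y)` is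
`C(n,k) · x^(n-k) · y^k`. -/
noncomputable def veronese (n : ℕ) (v : Fin 2 → ℂ) : Fin (n + 1) → ℂ :=
  fun k => (n.choose (k : ℕ) : ℂ) * v 0 ^ (n - (k : ℕ)) * v 1 ^ (k : ℕ)

/-- The matrix `ϱₙ(A)`: the n-th symmetric power of the 2×2 matrix `A` written in the
Veronese basis, given by the explicit entry formula. -/
noncomputable def rho (n : ℕ) (A : Matrix (Fin 2) (Fin 2) ℂ) :
    Matrix (Fin (n + 1)) (Fin (n + 1)) ℂ :=
  fun m j =>
    ((n.choose (m : ℕ) : ℂ) / (n.choose (j : ℕ) : ℂ)) *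
      ∑ l ∈ Finset.Icc ((j : ℕ) - (n - (m : ℕ))) (min (j : ℕ) (m : ℕ)),
        (((n - (m : ℕ)).choose ((j : ℕ) - l) : ℂ) * (((m : ℕ).choose l : ℕ) : ℂ)) *
          A 0 0 ^ (n - (m : ℕ) - ((j : ℕ) - l)) * A 0 1 ^ ((j : ℕ) - l) *
          A 1 0 ^ ((m : ℕ) - l) * A 1 1 ^ l

theorem rho_mulVec_veronese (n : ℕ) (A : Matrix (Fin 2) (Fin 2) ℂ) (v : Fin 2 → ℂ) :
    rho n A *ᵥ veronese n v = veronese n (A *ᵥ v) := by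
  ext m
  have hm : (m : ℕ) ≤ n := Nat.lt_succ_iff.mp m.2
  simp only [mulVec, dotProduct, rho, veronese, Fin.sum_univ_two]
  rw [add_comm (A 0 0 * v 0), add_comm (A 1 0 * v 0), add_pow, add_pow, mul_assoc,
    Finset.sum_mul_sum, ← Finset.sum_product', Finset.mul_sum]
  rw [← Finset.sum_fiberwise_of_maps_to (s := _ ×ˢ _) (t := Finset.range (n + 1))
    (g := fun p => p.1 + p.2)]
  · rw [Finset.sum_range]
    refine Finset.sum_congr rfl fun j _ => ?_
    have hj : (n.choose (j : ℕ) : ℂ) ≠ 0 := by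
      exact_mod_cast (Nat.choose_pos (Nat.lt_succ_iff.mp j.2)).ne'
    have hcancel : ∀ {a b : ℂ} (s x y : ℂ), b ≠ 0 → a / b * s * (b * x * y) = s * (a * x * y) := by
      intro a b s x y hb
      field_simp
    rw [hcancel _ _ _ hj, Finset.sum_mul]
    refine Finset.sum_bij (fun l _ => ((j : ℕ) - l, l)) ?_ ?_ ?_ ?_
    · intro l hl
      simp only [Finset.mem_Icc, Finset.mem_filter, Finset.mem_product, Finset.mem_range] at hl ⊢
      omega
    · intro l _ l' _ h
      exact (Prod.ext_iff.mp h).2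
    · rintro ⟨i, l⟩ hl
      simp only [Finset.mem_filter, Finset.mem_product, Finset.mem_range] at hl
      refine ⟨l, ?_, ?_⟩
      · simp only [Finset.mem_Icc]; omega
      · simp only [Prod.mk.injEq, and_true]; omega
    · intro l hl
      simp only [Finset.mem_Icc] at hl
      have e1 : n - (j : ℕ) = (n - (m : ℕ) - ((j : ℕ) - l)) + ((m : ℕ) - l) := by omega
      have e2 : v 1 ^ (j : ℕ) = v 1 ^ ((j : ℕ) - l) * v 1 ^ l := by
        rw [← pow_add]; congr 1; omega
      rw [e1, e2, pow_add]
      simp only [mul_pow]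
      ring
  · intro p hp
    simp only [Finset.mem_product, Finset.mem_range] at hp ⊢
    omega

theorem eq_of_mulVec_veronese (n : ℕ) {M N : Matrix (Fin (n + 1)) (Fin (n + 1)) ℂ}
    (h : ∀ v, M *ᵥ veronese n v = N *ᵥ veronese n v) : M = N := by
  ext m j
  let p : Matrix (Fin (n + 1)) (Fin (n + 1)) ℂ → Polynomial ℂ := fun M =>
    ∑ k : Fin (n + 1), Polynomial.monomial (k : ℕ) (M m k * (n.choose (k : ℕ) : ℂ))
  have hp : p M = p N := by
    refine Polynomial.funext fun t => ?_
    have := congrFun (h ![1, t]) m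
    simpa [p, mulVec, dotProduct, veronese, Polynomial.eval_finsetSum, mul_assoc] using this
  have hc : ∀ M, (p M).coeff (j : ℕ) = M m j * (n.choose (j : ℕ) : ℂ) := by
    intro M
    simp [p, Polynomial.finsetSum_coeff, Polynomial.coeff_monomial, Fin.val_inj]
  have hj : (n.choose (j : ℕ) : ℂ) ≠ 0 := by
    exact_mod_cast (Nat.choose_pos (Nat.lt_succ_iff.mp j.2)).ne'
  have := hc M
  rw [hp, hc N] at this
  exact (mul_right_cancel₀ hj this).symm

theorem rho_mul (n : ℕ) (A B : Matrix (Fin 2) (Fin 2) ℂ) :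
    rho n (A * B) = rho n A * rho n B :=
  eq_of_mulVec_veronese n fun v => by
    simp only [← mulVec_mulVec, rho_mulVec_veronese]

theorem rho_diagonal (n : ℕ) (D : Fin 2 → ℂ) :
    rho n (diagonal D) = diagonal fun k : Fin (n + 1) => D 0 ^ (n - (k : ℕ)) * D 1 ^ (k : ℕ) :=
  eq_of_mulVec_veronese n fun v => by
    rw [rho_mulVec_veronese]
    ext k
    simp only [veronese, mulVec_diagonal]
    ring

theorem rho_one (n : ℕ) : rho n 1 = 1 := by
  rw [← diagonal_one, rho_diagonal]
  simp

/-- A polynomial that a nontrivial translation merely rescales is constant. -/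
theorem eval_eq_eval_zero_of_smul_eq_translate {p : Polynomial ℂ} {a μ ν : ℂ} (ha : a ≠ 0)
    (hν : ν ≠ 0) (h : ∀ u, μ * p.eval u = ν * p.eval (u + a)) (u : ℂ) :
    p.eval u = p.eval 0 := by
  by_cases hp : p = 0
  · simp [hp]
  have hpoly : Polynomial.C μ * p = Polynomial.C ν * p.taylor a :=
    Polynomial.funext fun u => by simpa [Polynomial.taylor_eval] using h u
  have hlead := congrArg Polynomial.leadingCoeff hpoly
  simp only [Polynomial.leadingCoeff_mul, Polynomial.leadingCoeff_C,
    Polynomial.leadingCoeff_taylor] at hlead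
  obtain rfl : μ = ν := mul_right_cancel₀ (Polynomial.leadingCoeff_ne_zero.mpr hp) hlead
  have hper : ∀ k : ℕ, p.eval (k * a) = p.eval 0 := by
    intro k
    induction k with
    | zero => simp
    | succ k ih => rw [← ih, mul_left_cancel₀ hν (h (k * a))]; push_cast; ring_nf
  have hz : p - Polynomial.C (p.eval 0) = 0 := by
    refine Polynomial.eq_zero_of_infinite_isRoot _ (Set.Infinite.mono ?_
      (Set.infinite_range_of_injective (f := fun k : ℕ => (k : ℂ) * a) fun k l hkl => ?_))
    · rintro _ ⟨k, rfl⟩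
      simp [hper k]
    · exact_mod_cast mul_right_cancel₀ ha hkl
  simpa [sub_eq_zero] using congrArg (Polynomial.eval u) hz

theorem exists_diagonalization_of_mul_eq {ι : Type*} [Fintype ι] [DecidableEq ι]
    {A P : Matrix ι ι ℂ} {D : ι → ℂ} (hP : IsUnit P) (h : A * P = P * diagonal D) :
    ∃ P : Matrix ι ι ℂ, IsUnit P ∧ ∃ D : ι → ℂ, P⁻¹ * A * P = diagonal D :=
  ⟨P, hP, D, by
    rw [mul_assoc, h, nonsing_inv_mul_cancel_left _ _ ((isUnit_iff_isUnit_det P).mp hP)]⟩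

/-- A 2×2 complex matrix is diagonalizable or has a Jordan chain of length two. -/
theorem diagonalizable_or_exists_jordan_chain (A : Matrix (Fin 2) (Fin 2) ℂ) :
    (∃ P : Matrix (Fin 2) (Fin 2) ℂ, IsUnit P ∧
        ∃ D : Fin 2 → ℂ, P⁻¹ * A * P = diagonal D) ∨
      ∃ (l : ℂ) (v w : Fin 2 → ℂ), w ≠ 0 ∧ A *ᵥ w = l • w ∧ A *ᵥ v = l • v + w := by
  obtain ⟨s, hs⟩ := IsAlgClosed.exists_pow_nat_eq
    ((A 0 0 - A 1 1) ^ 2 + 4 * (A 0 1 * A 1 0)) (n := 2) two_pos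
  obtain ⟨l, hl⟩ : ∃ l, l = (A 0 0 + A 1 1 + s) / 2 := ⟨_, rfl⟩
  obtain ⟨r, hr⟩ : ∃ r, r = (A 0 0 + A 1 1 - s) / 2 := ⟨_, rfl⟩
  have hsum : l + r = A 0 0 + A 1 1 := by rw [hl, hr]; ring
  have hprod : l * r = A 0 0 * A 1 1 - A 0 1 * A 1 0 := by
    rw [hl, hr]; linear_combination -hs / 4
  clear hl hr hs
  have hr : r = A 0 0 + A 1 1 - l := by linear_combination hsum
  by_cases hb : A 0 1 = 0 ∧ A 1 0 = 0
  · refine .inl (exists_diagonalization_of_mul_eq (P := 1) (D := ![A 0 0, A 1 1]) isUnit_one ?_)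
    ext i j
    fin_cases i <;> fin_cases j <;> simp [hb]
  by_cases hlr : l = r
  · right
    subst hlr
    by_cases hb0 : A 0 1 = 0
    · have hc : A 1 0 ≠ 0 := fun h => hb ⟨hb0, h⟩
      refine ⟨l, ![1, 0], ![A 0 0 - l, A 1 0],
        fun h => hc (by simpa using congrFun h 1), ?_, ?_⟩ <;>
      · ext i
        fin_cases i <;> simp [mulVec, dotProduct, Fin.sum_univ_two] <;> grind
    · refine ⟨l, ![0, 1], ![A 0 1, A 1 1 - l],
        fun h => hb0 (by simpa using congrFun h 0), ?_, ?_⟩ <;>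
      · ext i
        fin_cases i <;> simp [mulVec, dotProduct, Fin.sum_univ_two] <;> grind
  · left
    by_cases hb0 : A 0 1 = 0
    · have hc : A 1 0 ≠ 0 := fun h => hb ⟨hb0, h⟩
      refine exists_diagonalization_of_mul_eq (P := !![l - A 1 1, r - A 1 1; A 1 0, A 1 0])
        (D := ![l, r]) ?_ ?_
      · rw [isUnit_iff_isUnit_det, isUnit_iff_ne_zero, det_fin_two_of]
        grind
      · ext i j
        fin_cases i <;> fin_cases j <;> simp [mul_apply, Fin.sum_univ_two] <;> grind
    · refine exists_diagonalization_of_mul_eq (P := !![A 0 1, A 0 1; l - A 0 0, r - A 0 0])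
        (D := ![l, r]) ?_ ?_
      · rw [isUnit_iff_isUnit_det, isUnit_iff_ne_zero, det_fin_two_of]
        grind
      · ext i j
        fin_cases i <;> fin_cases j <;> simp [mul_apply, Fin.sum_univ_two] <;> grind

theorem veronese_smul (n : ℕ) (c : ℂ) (v : Fin 2 → ℂ) :
    veronese n (c • v) = c ^ n • veronese n v := by
  ext k
  have hk : c ^ n = c ^ (n - (k : ℕ)) * c ^ (k : ℕ) := by
    rw [← pow_add, Nat.sub_add_cancel (Nat.lt_succ_iff.mp k.2)]
  simp only [veronese, Pi.smul_apply, smul_eq_mul, mul_pow, hk]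
  ring

/-- A linear functional of the Veronese lift is polynomial along affine lines. -/
theorem exists_polynomial_eval_eq_dotProduct_veronese (n : ℕ) (φ : Fin (n + 1) → ℂ)
    (v w : Fin 2 → ℂ) :
    ∃ p : Polynomial ℂ, ∀ u, p.eval u = φ ⬝ᵥ veronese n (v + u • w) := by
  open Polynomial in
  refine ⟨∑ k : Fin (n + 1), C (φ k) * (C (n.choose (k : ℕ) : ℂ) *
    (C (v 0) + X * C (w 0)) ^ (n - (k : ℕ)) * (C (v 1) + X * C (w 1)) ^ (k : ℕ)), fun u => ?_⟩
  simp [eval_finsetSum, dotProduct, veronese, mul_comm u]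

theorem veronese_line_not_constant {n : ℕ} (hn : n ≠ 0) (v : Fin 2 → ℂ) {w : Fin 2 → ℂ}
    (hw : w ≠ 0) : ¬ ∀ u : ℂ, veronese n (v + u • w) = veronese n v := by
  intro h
  have key : ∀ i : Fin 2, w i = 0 := by
    intro i
    by_contra hi
    have hpow : ∀ u, (v i + u * w i) ^ n = v i ^ n := by
      intro u
      fin_cases i
      · simpa [veronese] using congrFun (h u) 0
      · simpa [veronese] using congrFun (h u) (Fin.last n)
    have h0 := hpow (-v i / w i)
    have h1 := hpow ((1 - v i) / w i)
    rw [div_mul_cancel₀ _ hi] at h0 h1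
    rw [← h0] at h1
    simp [hn] at h1
  exact hw (funext key)

theorem not_diagonalizable_rho_of_jordan_chain {n : ℕ} (hn : n ≠ 0)
    {A : Matrix (Fin 2) (Fin 2) ℂ} {l : ℂ} (hl : l ≠ 0) {v w : Fin 2 → ℂ} (hw : w ≠ 0)
    (hAw : A *ᵥ w = l • w) (hAv : A *ᵥ v = l • v + w) :
    ¬ ∃ Q : Matrix (Fin (n + 1)) (Fin (n + 1)) ℂ, IsUnit Q ∧
        ∃ D : Fin (n + 1) → ℂ, Q⁻¹ * rho n A * Q = diagonal D := by
  rintro ⟨Q, hQ, D, hD⟩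
  have hdet := (isUnit_iff_isUnit_det Q).mp hQ
  have hQR : Q⁻¹ * rho n A = diagonal D * Q⁻¹ := by
    rw [← hD, mul_nonsing_inv_cancel_right _ _ hdet]
  have hshift : ∀ u : ℂ, rho n A *ᵥ veronese n (v + u • w)
      = l ^ n • veronese n (v + (u + l⁻¹) • w) := by
    intro u
    rw [rho_mulVec_veronese, ← veronese_smul, mulVec_add, mulVec_smul, hAw, hAv]
    congr 1
    ext i
    simp only [Pi.add_apply, Pi.smul_apply, smul_eq_mul]
    field_simp
    ring
  refine veronese_line_not_constant hn v hw fun u => ?_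
  have hconst : Q⁻¹ *ᵥ veronese n (v + u • w) = Q⁻¹ *ᵥ veronese n v := by
    ext i
    obtain ⟨p, hp⟩ := exists_polynomial_eval_eq_dotProduct_veronese n (Q⁻¹ i) v w
    have hp' : ∀ u, p.eval u = (Q⁻¹ *ᵥ veronese n (v + u • w)) i := hp
    have hev : ∀ u, D i * p.eval u = l ^ n * p.eval (u + l⁻¹) := by
      intro u
      have := congrFun (congrArg (· *ᵥ veronese n (v + u • w)) hQR) i
      simp only [← mulVec_mulVec, hshift, mulVec_smul, mulVec_diagonal] at this
      simpa [hp'] using this.symm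
    have := eval_eq_eval_zero_of_smul_eq_translate (inv_ne_zero hl) (pow_ne_zero n hl) hev u
    simpa [hp'] using this
  simpa [mulVec_mulVec, mul_nonsing_inv _ hdet] using congrArg (Q *ᵥ ·) hconst

/-- For an invertible 2×2 complex matrix `A`, `A` is diagonalizable if and only if `ϱₙ(A)`
is diagonalizable. In particular `ϱₙ` sends parabolic (non-diagonalizable) elements to
non-diagonalizable matrices, and elliptic/loxodromic elements to diagonalizable ones. -/
theorem rho_diagonalizable_iff (n : ℕ) (hn : 1 ≤ n) (A : Matrix (Fin 2) (Fin 2) ℂ)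
    (hA : IsUnit A) :
    (∃ P : Matrix (Fin 2) (Fin 2) ℂ, IsUnit P ∧
        ∃ D : Fin 2 → ℂ, P⁻¹ * A * P = Matrix.diagonal D) ↔
      (∃ Q : Matrix (Fin (n + 1)) (Fin (n + 1)) ℂ, IsUnit Q ∧
        ∃ D : Fin (n + 1) → ℂ, Q⁻¹ * rho n A * Q = Matrix.diagonal D) := by
  constructor
  · rintro ⟨P, hP, D, hD⟩
    have hdet := (isUnit_iff_isUnit_det P).mp hP
    have hinv : rho n P * rho n P⁻¹ = 1 := by
      rw [← rho_mul, mul_nonsing_inv _ hdet, rho_one]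
    have hAP : A * P = P * diagonal D := by
      rw [← hD, mul_assoc, mul_nonsing_inv_cancel_left _ _ hdet]
    refine exists_diagonalization_of_mul_eq (IsUnit.of_mul_eq_one _ hinv)
      (D := fun k => D 0 ^ (n - (k : ℕ)) * D 1 ^ (k : ℕ)) ?_
    rw [← rho_mul, hAP, rho_mul, rho_diagonal]
  · intro h
    refine (diagonalizable_or_exists_jordan_chain A).resolve_right ?_
    rintro ⟨l, v, w, hw, hAw, hAv⟩
    have hl : l ≠ 0 := by
      rintro rfl
      exact hw (mulVec_injective_of_isUnit hA (by simpa using hAw))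
    exact not_diagonalizable_rho_of_jordan_chain (by omega) hl hw hAw hAv h
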